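/- For every integer n ≥ 2, the set of real numbers α such that φ_α[A] is positive semidefinite for every n×n real symmetric positive semidefinite matrix A equals {even positive integers} ∪ [n−2, ∞). -/

import Mathlib

open Matrix

/-- Entrywise power with the convention `0 ^ α := 0` for all `α`. -/
noncomputable def powF (α x : ℝ) : ℝ := if x = 0 then 0 else x ^ α

/-- `ψ_α(x) := sgn(x) * |x| ^ α`, with `ψ_α(0) := 0`. -/
noncomputable def psiF (α x : ℝ) : ℝ := if x = 0 then 0 else Real.sign x * |x| ^ α

/-- `φ_α(x) := |x| ^ α`, with `φ_α(0) := 0`. -/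
noncomputable def phiF (α x : ℝ) : ℝ := if x = 0 then 0 else |x| ^ α


theorem psd_iff {n : ℕ} (M : Matrix (Fin n) (Fin n) ℝ) :
    M.PosSemidef ↔ (∀ i j, M i j = M j i) ∧ ∀ v : Fin n → ℝ, 0 ≤ ∑ i, ∑ j, v i * v j * M i j := by
  rw [Matrix.posSemidef_iff_dotProduct_mulVec]
  refine and_congr ?_ (forall_congr' fun v => ?_)
  · rw [Matrix.IsHermitian.ext_iff]
    constructor
    · intro h i j
      have := h i j
      simpa using this.symm
    · intro h i j
      simpa using (h i j).symm
  · have : star v ⬝ᵥ (M *ᵥ v) = ∑ i, ∑ j, v i * v j * M i j := by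
      simp only [dotProduct, mulVec, Finset.mul_sum]
      refine Finset.sum_congr rfl fun i _ => Finset.sum_congr rfl fun j _ => ?_
      simp; ring
    rw [this]

noncomputable def wgt (N i : ℕ) : ℝ := (-1 : ℝ) ^ (N - i) * (N.choose i : ℝ)

theorem wgt_poly (N : ℕ) (P : Polynomial ℝ) (hP : P.natDegree < N) :
    ∑ i ∈ Finset.range (N + 1), wgt N i * P.eval (i : ℝ) = 0 := by
  have h := congrFun (Polynomial.fwdDiff_iter_eq_zero_of_degree_lt hP) 0
  rw [fwdDiff_iter_eq_sum_shift] at h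
  simpa [wgt] using h

theorem wgt_pow (N k : ℕ) (hP : k < N) :
    ∑ i ∈ Finset.range (N + 1), wgt N i * (i : ℝ) ^ k = 0 := by
  simpa using wgt_poly N (Polynomial.X ^ k) (by simpa using hP)

theorem wgt_pow_self (N : ℕ) :
    ∑ i ∈ Finset.range (N + 1), wgt N i * (i : ℝ) ^ N = (N.factorial : ℝ) := by
  have h := congrFun (fwdDiff_iter_eq_factorial (R := ℝ) (n := N)) 0
  rw [fwdDiff_iter_eq_sum_shift] at h
  simpa [wgt] using h

theorem wgt_lin (N k : ℕ) (a b : ℝ) (hP : k < N) :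
    ∑ i ∈ Finset.range (N + 1), wgt N i * (a * (i : ℝ) + b) ^ k = 0 := by
  have := wgt_poly N ((Polynomial.C a * Polynomial.X + Polynomial.C b) ^ k) ?_
  · simpa using this
  · refine lt_of_le_of_lt Polynomial.natDegree_pow_le ?_
    have := Polynomial.natDegree_linear_le (a := a) (b := b)
    calc _ ≤ k * 1 := Nat.mul_le_mul_left _ this
      _ < N := by omega

theorem rank_two_psd (n : ℕ) (u : ℕ → ℝ) :
    (Matrix.of fun i j : Fin n => 1 + u i * u j).PosSemidef := by
  rw [psd_iff]
  constructor
  · intro i j; simp; ring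
  · intro v
    have : ∑ i, ∑ j, v i * v j * (Matrix.of fun i j : Fin n => 1 + u i * u j) i j
        = (∑ i, v i) ^ 2 + (∑ i, v i * u i) ^ 2 := by
      rw [sq, sq, Finset.sum_mul_sum, Finset.sum_mul_sum, ← Finset.sum_add_distrib]
      refine Finset.sum_congr rfl fun i _ => ?_
      rw [← Finset.sum_add_distrib]
      refine Finset.sum_congr rfl fun j _ => ?_
      simp; ring
    rw [this]; positivity

theorem test_nonneg {n : ℕ} {α : ℝ}
    (h : ∀ A : Matrix (Fin n) (Fin n) ℝ, A.PosSemidef → (A.map (phiF α)).PosSemidef)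
    (N : ℕ) (hN : N + 1 ≤ n) (u : ℕ → ℝ) :
    0 ≤ ∑ i ∈ Finset.range (N + 1), ∑ j ∈ Finset.range (N + 1),
      wgt N i * wgt N j * phiF α (1 + u i * u j) := by
  have h1 := ((psd_iff _).1 (h _ (rank_two_psd n u))).2 (fun i => wgt N i)
  have key : ∀ f : ℕ → ℝ, ∑ i : Fin n, wgt N i * f i
      = ∑ i ∈ Finset.range (N + 1), wgt N i * f i := by
    intro f
    rw [Fin.sum_univ_eq_sum_range (fun i => wgt N i * f i)]
    symm
    apply Finset.sum_subset (Finset.range_subset_range.2 hN)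
    intro i _ hi
    have : N < i := by simpa using hi
    simp [wgt, Nat.choose_eq_zero_of_lt this]
  have e : ∑ i : Fin n, ∑ j : Fin n, wgt N i * wgt N j *
      ((Matrix.of fun i j : Fin n => 1 + u i * u j).map (phiF α)) i j
      = ∑ i ∈ Finset.range (N + 1), ∑ j ∈ Finset.range (N + 1),
      wgt N i * wgt N j * phiF α (1 + u i * u j) := by
    simp only [Matrix.map_apply, Matrix.of_apply, mul_assoc, ← Finset.mul_sum]
    rw [key (fun i => ∑ j : Fin n, wgt N j * phiF α (1 + u i * u j))]
    refine Finset.sum_congr rfl fun i _ => ?_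
    rw [key (fun j => phiF α (1 + u i * u j))]
  rw [e] at h1
  exact h1

theorem nec_neg {n : ℕ} (hn : 2 ≤ n) {α : ℝ} (hα : α < 0)
    (h : ∀ A : Matrix (Fin n) (Fin n) ℝ, A.PosSemidef → (A.map (phiF α)).PosSemidef) : False := by
  have := test_nonneg h 1 hn (fun i => (i : ℝ))
  have h2 : (2 : ℝ) ^ α < 1 := Real.rpow_lt_one_of_one_lt_of_neg (by norm_num) hα
  norm_num [Finset.sum_range_succ, wgt, phiF] at this
  linarith

theorem nec_zero {n : ℕ} (hn : 3 ≤ n)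
    (h : ∀ A : Matrix (Fin n) (Fin n) ℝ, A.PosSemidef → (A.map (phiF 0)).PosSemidef) : False := by
  have := test_nonneg h 2 hn (fun i => (i : ℝ) - 1)
  norm_num [Finset.sum_range_succ, wgt, phiF] at this

theorem nec_odd {n p : ℕ} (hp : Odd p) (hn : p + 3 ≤ n)
    (h : ∀ A : Matrix (Fin n) (Fin n) ℝ, A.PosSemidef → (A.map (phiF p)).PosSemidef) : False := by
  have hp1 : 1 ≤ p := hp.pos
  set N := p + 2 with hNdef
  have hN0 : (3 : ℝ) ≤ N := by rw [hNdef]; push_cast; have : (1 : ℝ) ≤ p := by exact_mod_cast hp1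
                               linarith
  set u : ℕ → ℝ := fun i => 2 / ((N : ℝ) - 1) * (i : ℝ) + -(N / ((N : ℝ) - 1)) with hu
  have ht := test_nonneg h N (by omega) u
  have hpoly : ∑ i ∈ Finset.range (N + 1), ∑ j ∈ Finset.range (N + 1),
      wgt N i * wgt N j * (1 + u i * u j) ^ p = 0 := by
    have e : ∀ i j, wgt N i * wgt N j * (1 + u i * u j) ^ p
        = ∑ l ∈ Finset.range (p + 1), (p.choose l : ℝ) * ((wgt N i * u i ^ l) * (wgt N j * u j ^ l)) := by
      intro i j
      rw [add_comm (1 : ℝ), add_pow, Finset.mul_sum]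
      refine Finset.sum_congr rfl fun l _ => ?_
      rw [mul_pow, one_pow]; ring
    simp only [e]
    have e2 : ∀ i, ∑ j ∈ Finset.range (N + 1), ∑ l ∈ Finset.range (p + 1),
        (p.choose l : ℝ) * ((wgt N i * u i ^ l) * (wgt N j * u j ^ l)) = 0 := by
      intro i
      rw [Finset.sum_comm]
      refine Finset.sum_eq_zero fun l hl => ?_
      rw [← Finset.mul_sum, ← Finset.mul_sum]
      have : l < N := by have := Finset.mem_range.1 hl; omega
      rw [hu, wgt_lin N l _ _ this]; simp
    exact Finset.sum_eq_zero fun i _ => e2 i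
  -- difference
  set D : ℕ → ℕ → ℝ := fun i j => phiF p (1 + u i * u j) - (1 + u i * u j) ^ p with hD
  have hDz : ∀ x : ℝ, 0 ≤ x → phiF p x - x ^ p = 0 := by
    intro x hx
    unfold phiF
    split_ifs with h0
    · rw [h0, zero_pow (by omega)]; simp
    · rw [abs_of_nonneg hx, Real.rpow_natCast]; simp
  have hDn : ∀ x : ℝ, x < 0 → 0 < phiF p x - x ^ p := by
    intro x hx
    unfold phiF
    rw [if_neg hx.ne, Real.rpow_natCast]
    have := hp.pow_neg hx
    have : 0 ≤ |x| ^ p := by positivity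
    linarith
  have hue : ∀ i : ℕ, u i = (2 * i - N) / (N - 1) := by
    intro i; rw [hu]; ring
  have hpos : (0 : ℝ) < N - 1 := by linarith
  have hne : ∀ i ≤ N, ∀ j ≤ N, (i, j) ≠ (0, N) → (i, j) ≠ (N, 0) → D i j = 0 := by
    intro i hi j hj h1 h2
    apply hDz
    rw [hue, hue, div_mul_div_comm]
    have : 0 ≤ ((N : ℝ) - 1) * (N - 1) + (2 * i - N) * (2 * j - N) := by
      have hi' : (i : ℝ) ≤ N := by exact_mod_cast hi
      have hj' : (j : ℝ) ≤ N := by exact_mod_cast hj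
      have hi0 : (0 : ℝ) ≤ i := by positivity
      have hj0 : (0 : ℝ) ≤ j := by positivity
      rcases Nat.eq_zero_or_pos i with rfl | hi1
      · have : j ≤ N - 1 := by
          by_contra hc
          exact h1 (by rw [show j = N by omega])
        have : (j : ℝ) ≤ N - 1 := by
          have h3 : j + 1 ≤ N := by omega
          have : ((j : ℝ) + 1) ≤ N := by exact_mod_cast h3
          linarith
        push_cast
        nlinarith
      · have hi1' : (1 : ℝ) ≤ i := by exact_mod_cast hi1
        rcases eq_or_lt_of_le hi with rfl | hi2
        · have : 1 ≤ j := by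
            by_contra hc
            exact h2 (by rw [show j = 0 by omega])
          have : (1 : ℝ) ≤ j := by exact_mod_cast this
          nlinarith
        · have hi2' : (i : ℝ) ≤ N - 1 := by
            have h3 : i + 1 ≤ N := by omega
            have : ((i : ℝ) + 1) ≤ N := by exact_mod_cast h3
            linarith
          have a1 : |2 * (i : ℝ) - N| ≤ N - 2 := abs_le.2 ⟨by linarith, by linarith⟩
          have a2 : |2 * (j : ℝ) - N| ≤ N := abs_le.2 ⟨by linarith, by linarith⟩
          have a3 := mul_le_mul a1 a2 (abs_nonneg _) (by linarith)
          rw [← abs_mul] at a3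
          have a4 := neg_abs_le ((2 * (i : ℝ) - N) * (2 * j - N))
          nlinarith
    have e : 1 + (2 * (i : ℝ) - N) * (2 * j - N) / ((N - 1) * (N - 1))
        = (((N : ℝ) - 1) * (N - 1) + (2 * i - N) * (2 * j - N)) / ((N - 1) * (N - 1)) := by
      field_simp
    rw [e]; positivity
  have hneg : 1 + u 0 * u N < 0 := by
    rw [hue, hue]
    have e : 1 + (2 * ((0 : ℕ) : ℝ) - N) / (N - 1) * ((2 * N - N) / (N - 1))
        = (((N : ℝ) - 1) * (N - 1) - N * N) / ((N - 1) * (N - 1)) := by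
      field_simp; push_cast; ring
    rw [e]
    apply div_neg_of_neg_of_pos _ (by positivity)
    nlinarith
  have hD0 : 0 < D 0 N := hDn _ hneg
  have hD1 : 0 < D N 0 := hDn _ (by rw [mul_comm]; exact hneg)
  have hNodd : Odd N := by rw [hNdef]; exact hp.add_even (by decide)
  have w0 : wgt N 0 = -1 := by simp [wgt, hNodd.neg_one_pow]
  have wN : wgt N N = 1 := by simp [wgt]
  have hN1 : (0 : ℕ) ≠ N := by omega
  have hsum : ∑ x ∈ Finset.range (N + 1) ×ˢ Finset.range (N + 1),
      wgt N x.1 * wgt N x.2 * D x.1 x.2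
      = ∑ x ∈ ({(0, N), (N, 0)} : Finset (ℕ × ℕ)), wgt N x.1 * wgt N x.2 * D x.1 x.2 := by
    symm
    apply Finset.sum_subset
    · intro x hx
      simp only [Finset.mem_insert, Finset.mem_singleton] at hx
      rcases hx with rfl | rfl <;> simp
    · rintro ⟨i, j⟩ hx hx2
      simp only [Finset.mem_product, Finset.mem_range] at hx
      simp only [Finset.mem_insert, Finset.mem_singleton, not_or] at hx2
      rw [hne i (by omega) j (by omega) hx2.1 hx2.2, mul_zero]
  rw [Finset.sum_pair (by simp [hN1])] at hsum
  simp only [w0, wN] at hsum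
  rw [Finset.sum_product] at hsum
  have : ∑ i ∈ Finset.range (N + 1), ∑ j ∈ Finset.range (N + 1), wgt N i * wgt N j * D i j
      = ∑ i ∈ Finset.range (N + 1), ∑ j ∈ Finset.range (N + 1),
          wgt N i * wgt N j * phiF p (1 + u i * u j) - 0 := by
    rw [← hpoly, ← Finset.sum_sub_distrib]
    refine Finset.sum_congr rfl fun i _ => ?_
    rw [← Finset.sum_sub_distrib]
    refine Finset.sum_congr rfl fun j _ => ?_
    rw [hD]; ring
  simp only at hsum
  linarith

theorem choose_neg_of {α : ℝ} {m : ℕ} (h1 : (m : ℝ) < α) (h2 : α < m + 1) :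
    Ring.choose α (m + 2) < 0 := by
  have hs : ∀ k : ℕ, (descPochhammer ℤ (k + 1)).smeval α
      = (descPochhammer ℤ k).smeval α * (α - k) := by
    intro k
    simp [descPochhammer_succ_right, Polynomial.smeval_mul, Polynomial.smeval_natCast]
  have h : ∀ k ≤ m + 1, 0 < (descPochhammer ℤ k).smeval α := by
    intro k
    induction k with
    | zero => intro _; simp
    | succ k ih =>
      intro hk
      rw [hs]
      have : (k : ℝ) ≤ m := by exact_mod_cast (by omega : k ≤ m)
      exact mul_pos (ih (by omega)) (by linarith)
  have h3 : (descPochhammer ℤ (m + 2)).smeval α < 0 := by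
    rw [hs]
    exact mul_neg_of_pos_of_neg (h _ le_rfl) (by push_cast; linarith)
  have h4 := Ring.descPochhammer_eq_factorial_smul_choose α (m + 2)
  rw [nsmul_eq_mul] at h4
  have h5 : (0 : ℝ) < ((m + 2).factorial : ℝ) := by positivity
  by_contra hc
  push Not at hc
  have := mul_nonneg h5.le hc
  linarith

open Filter Topology Asymptotics in
theorem nec_frac {n m : ℕ} {α : ℝ} (h1 : (m : ℝ) < α) (h2 : α < m + 1) (hn : m + 3 ≤ n)
    (h : ∀ A : Matrix (Fin n) (Fin n) ℝ, A.PosSemidef → (A.map (phiF α)).PosSemidef) : False := by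
  set N := m + 2 with hN
  set c : ℕ → ℝ := fun k => Ring.choose α k with hc
  have hcN : c N < 0 := choose_neg_of h1 h2
  set F : ℝ → ℝ := fun y => (1 + y) ^ α - ∑ k ∈ Finset.range (N + 1), c k * y ^ k with hF
  have hFO : F =O[𝓝 0] fun y => y ^ (N + 1) := by
    have := (Real.one_add_rpow_hasFPowerSeriesAt_zero (a := α)).isBigO_sub_partialSum_pow (N + 1)
    simp only [zero_add, FormalMultilinearSeries.partialSum, binomialSeries_apply] at this
    refine IsBigO.trans (this.congr_left ?_) ?_
    · intro y
      simp [hF, hc]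
    · refine IsBigO.of_bound 1 (Eventually.of_forall fun y => ?_)
      simp
  set G : ℝ → ℝ := fun ε => ∑ i ∈ Finset.range (N + 1), ∑ j ∈ Finset.range (N + 1),
      wgt N i * wgt N j * F (ε * ((i : ℝ) * j)) with hG
  have hGO : G =O[𝓝 0] fun y => y ^ (N + 1) := by
    rw [hG]
    refine IsBigO.fun_sum fun i _ => IsBigO.fun_sum fun j _ => IsBigO.const_mul_left ?_ _
    have ht : Tendsto (fun ε : ℝ => ε * ((i : ℝ) * j)) (𝓝 0) (𝓝 0) := by
      have : Continuous (fun ε : ℝ => ε * ((i : ℝ) * j)) := by fun_prop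
      simpa using this.tendsto 0
    refine (hFO.comp_tendsto ht).trans ?_
    simp only [Function.comp_def, mul_pow]
    simp only [mul_comm _ (((i : ℝ) ^ (N + 1)) * (j : ℝ) ^ (N + 1))]
    exact (isBigO_refl _ _).const_mul_left _
  have hGo : G =o[𝓝 0] fun y => y ^ N :=
    hGO.trans_isLittleO (isLittleO_pow_pow (by omega))
  have hC : 0 < -(c N) * (N.factorial : ℝ) ^ 2 / 2 := by
    have : 0 < -(c N) := by linarith
    positivity
  have hev := (hGo.bound hC)
  have hev2 : ∀ᶠ ε in 𝓝[>] (0 : ℝ), ‖G ε‖ ≤ -(c N) * (N.factorial : ℝ) ^ 2 / 2 * ‖ε ^ N‖ :=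
    hev.filter_mono nhdsWithin_le_nhds
  obtain ⟨ε, hb, hε⟩ := (hev2.and self_mem_nhdsWithin).exists
  have hε : 0 < ε := hε
  have ht := test_nonneg h N (by omega) (fun i => √ε * i)
  have e1 : ∀ i j : ℕ, phiF α (1 + √ε * i * (√ε * j)) = ∑ k ∈ Finset.range (N + 1),
      c k * (ε * ((i : ℝ) * j)) ^ k + F (ε * ((i : ℝ) * j)) := by
    intro i j
    have : √ε * i * (√ε * j) = ε * ((i : ℝ) * j) := by
      have := Real.mul_self_sqrt hε.le
      linear_combination (i : ℝ) * j * this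
    rw [this]
    have : 0 < 1 + ε * ((i : ℝ) * j) := by positivity
    simp only [hF, phiF, if_neg this.ne', abs_of_pos this]
    ring
  simp only [e1, mul_add, Finset.sum_add_distrib] at ht
  change 0 ≤ _ + G ε at ht
  have e2 : ∑ i ∈ Finset.range (N + 1), ∑ j ∈ Finset.range (N + 1), wgt N i * wgt N j *
      ∑ k ∈ Finset.range (N + 1), c k * (ε * ((i : ℝ) * j)) ^ k
      = c N * ε ^ N * (N.factorial : ℝ) ^ 2 := by
    have e3 : ∀ i j : ℕ, wgt N i * wgt N j *
      ∑ k ∈ Finset.range (N + 1), c k * (ε * ((i : ℝ) * j)) ^ k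
      = ∑ k ∈ Finset.range (N + 1), c k * ε ^ k * ((wgt N i * (i : ℝ) ^ k) * (wgt N j * (j : ℝ) ^ k)) := by
      intro i j
      rw [Finset.mul_sum]
      refine Finset.sum_congr rfl fun k _ => ?_
      rw [mul_pow, mul_pow]; ring
    simp only [e3]
    have e4 : ∀ i : ℕ, ∑ j ∈ Finset.range (N + 1), ∑ k ∈ Finset.range (N + 1),
        c k * ε ^ k * ((wgt N i * (i : ℝ) ^ k) * (wgt N j * (j : ℝ) ^ k))
        = c N * ε ^ N * ((wgt N i * (i : ℝ) ^ N) * (N.factorial : ℝ)) := by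
      intro i
      rw [Finset.sum_comm]
      simp only [← Finset.mul_sum]
      rw [Finset.sum_range_succ, wgt_pow_self, Finset.sum_eq_zero, zero_add]
      intro k hk
      rw [wgt_pow N k (Finset.mem_range.1 hk)]; simp
    simp only [e4]
    rw [← Finset.mul_sum, ← Finset.sum_mul, wgt_pow_self]; ring
  rw [e2] at ht
  rw [Real.norm_eq_abs, Real.norm_eq_abs, abs_of_pos (pow_pos hε N)] at hb
  have hb' := le_abs_self (G ε)
  have : 0 < -(c N) * (N.factorial : ℝ) ^ 2 / 2 * ε ^ N := mul_pos hC (pow_pos hε N)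
  nlinarith

theorem phiF_mul (α x y : ℝ) : phiF α (x * y) = phiF α x * phiF α y := by
  unfold phiF
  by_cases hx : x = 0
  · simp [hx]
  by_cases hy : y = 0
  · simp [hy]
  simp [hx, hy, abs_mul, Real.mul_rpow (abs_nonneg x) (abs_nonneg y)]

theorem phiF_nonneg (α x : ℝ) : 0 ≤ phiF α x := by
  unfold phiF; split_ifs <;> positivity

theorem psiF_eq (α x : ℝ) : psiF α x = Real.sign x * phiF α x := by
  unfold psiF phiF; split_ifs <;> simp

theorem sign_mul_real (x y : ℝ) : Real.sign (x * y) = Real.sign x * Real.sign y := by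
  rcases lt_trichotomy x 0 with hx | hx | hx <;> rcases lt_trichotomy y 0 with hy | hy | hy <;>
  simp [hx, hy, Real.sign_of_neg, Real.sign_of_pos, mul_pos_of_neg_of_neg, mul_neg_of_neg_of_pos,
    mul_neg_of_pos_of_neg]

theorem psiF_mul (α x y : ℝ) : psiF α (x * y) = psiF α x * psiF α y := by
  rw [psiF_eq, psiF_eq, psiF_eq, phiF_mul, sign_mul_real]; ring

theorem psiF_nonneg (α : ℝ) {x : ℝ} (hx : 0 ≤ x) : 0 ≤ psiF α x := by
  rw [psiF_eq]
  refine mul_nonneg ?_ (phiF_nonneg _ _)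
  rcases hx.eq_or_lt with h | h
  · rw [← h, Real.sign_zero]
  · rw [Real.sign_of_pos h]; exact zero_le_one

theorem phiF_mono {α : ℝ} (hα : 0 ≤ α) {x y : ℝ} (hx : 0 ≤ x) (hxy : x ≤ y) :
    phiF α x ≤ phiF α y := by
  by_cases h0 : x = 0
  · rw [h0]; simpa [phiF] using phiF_nonneg α y
  · have hx' : 0 < x := lt_of_le_of_ne hx (Ne.symm h0)
    have hy : 0 < y := by linarith
    unfold phiF
    rw [if_neg h0, if_neg hy.ne', abs_of_pos hx', abs_of_pos hy]
    exact Real.rpow_le_rpow hx hxy hα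

theorem phiF_deriv {α : ℝ} (hα : 1 < α) (x : ℝ) :
    HasDerivAt (phiF α) (α * psiF (α - 1) x) x := by
  have e : phiF α = fun x => |x| ^ α := by
    ext y; unfold phiF; split_ifs with h
    · rw [h, abs_zero, Real.zero_rpow (by linarith)]
    · rfl
  have h := hasDerivAt_abs_rpow x hα
  rw [e]
  convert h using 1
  unfold psiF
  split_ifs with h0
  · simp [h0]
  · have hp : 0 < |x| := abs_pos.2 h0
    have : |x| ^ (α - 1) = |x| ^ (α - 2) * |x| := by
      rw [← Real.rpow_add_one hp.ne']; congr 1; ring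
    rw [this]
    have : Real.sign x * |x| = x := by
      rcases lt_or_gt_of_ne h0 with h | h
      · rw [Real.sign_of_neg h, abs_of_neg h]; ring
      · rw [Real.sign_of_pos h, abs_of_pos h]; ring
    linear_combination α * |x| ^ (α - 2) * this

theorem psiF_deriv {α : ℝ} (hα : 1 < α) (x : ℝ) :
    HasDerivAt (psiF α) (α * phiF (α - 1) x) x := by
  have hs : ∀ x : ℝ, x ≠ 0 → Real.sign x * |x| = x := by
    intro x h0
    rcases lt_or_gt_of_ne h0 with h | h
    · rw [Real.sign_of_neg h, abs_of_neg h]; ring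
    · rw [Real.sign_of_pos h, abs_of_pos h]; ring
  have e : psiF α = fun x => x * |x| ^ (α - 1) := by
    ext y; unfold psiF; split_ifs with h
    · rw [h, zero_mul]
    · have hp : 0 < |y| := abs_pos.2 h
      have : |y| ^ α = |y| ^ (α - 1) * |y| := by
        rw [← Real.rpow_add_one hp.ne']; congr 1; ring
      rw [this]
      linear_combination |y| ^ (α - 1) * hs y h
  rw [e]
  by_cases h0 : x = 0
  · subst h0
    simp only [phiF, if_true, mul_zero]
    rw [hasDerivAt_iff_tendsto_slope]
    have hc : Continuous fun y : ℝ => |y| ^ (α - 1) :=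
      continuous_abs.rpow_const (fun _ => Or.inr (by linarith))
    have ht := hc.tendsto 0
    simp only [abs_zero, Real.zero_rpow (show α - 1 ≠ 0 by linarith)] at ht
    refine (ht.mono_left nhdsWithin_le_nhds).congr' ?_
    filter_upwards [self_mem_nhdsWithin] with y hy
    have hy : y ≠ 0 := hy
    simp [slope_def_field]
    field_simp
  · have hp : 0 < |x| := abs_pos.2 h0
    have habs : HasDerivAt (fun y : ℝ => |y|) (Real.sign x) x := by
      rcases lt_or_gt_of_ne h0 with h | h
      · rw [Real.sign_of_neg h]; exact hasDerivAt_abs_neg h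
      · rw [Real.sign_of_pos h]; exact hasDerivAt_abs_pos h
    have h1 := habs.rpow_const (p := α - 1) (Or.inl hp.ne')
    have h2 := (hasDerivAt_id x).mul h1
    refine h2.congr_deriv ?_
    have : |x| ^ (α - 1) = |x| ^ (α - 1 - 1) * |x| := by
      rw [← Real.rpow_add_one hp.ne']; congr 1; ring
    simp only [phiF, if_neg h0, id, this]
    have hx := hs x h0
    have hss : Real.sign x * Real.sign x = 1 := by
      rcases lt_or_gt_of_ne h0 with h | h
      · rw [Real.sign_of_neg h]; ring
      · rw [Real.sign_of_pos h]; ring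
    have hxs : x * Real.sign x = |x| := by
      linear_combination |x| * hss - Real.sign x * hx
    linear_combination (α - 1) * |x| ^ (α - 1 - 1) * hxs

theorem psd_sq_le {n : ℕ} {A : Matrix (Fin n) (Fin n) ℝ} (hA : A.PosSemidef) (i j : Fin n) :
    A i j ^ 2 ≤ A i i * A j j := by
  have h := (hA.submatrix ![i, j]).det_nonneg
  have hs := ((psd_iff A).1 hA).1 i j
  rw [Matrix.det_fin_two] at h
  simp at h
  rw [← hs] at h
  nlinarith

theorem psd_diag {n : ℕ} {A : Matrix (Fin n) (Fin n) ℝ} (hA : A.PosSemidef) (i : Fin n) :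
    0 ≤ A i i := hA.diag_nonneg

theorem base_two (f : ℝ → ℝ) {α : ℝ} (hα : 0 ≤ α) (hf : ∀ x, 0 ≤ x → 0 ≤ f x)
    (hf2 : ∀ x, f x ^ 2 ≤ phiF α (x ^ 2)) (hf3 : ∀ x, 0 ≤ x → f x = phiF α x)
    (A : Matrix (Fin 2) (Fin 2) ℝ) (hA : A.PosSemidef) : (A.map f).PosSemidef := by
  have hs := ((psd_iff A).1 hA).1
  rw [psd_iff]
  refine ⟨fun i j => by simp [hs i j], fun v => ?_⟩
  simp only [Fin.sum_univ_two, Matrix.map_apply]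
  rw [hs 1 0]
  have ha := psd_diag hA 0
  have hc := psd_diag hA 1
  have hq : f (A 0 1) ^ 2 ≤ f (A 0 0) * f (A 1 1) := by
    rw [hf3 _ ha, hf3 _ hc, ← phiF_mul]
    exact (hf2 _).trans (phiF_mono hα (sq_nonneg _) (psd_sq_le hA 0 1))
  have hp := hf _ ha
  have hr := hf _ hc
  generalize f (A 0 0) = p at *
  generalize f (A 1 1) = r at *
  generalize f (A 0 1) = q at *
  generalize v 0 = x
  generalize v 1 = y
  rcases hp.eq_or_lt with h0 | h0
  · have : q = 0 := by
      rw [← h0, zero_mul] at hq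
      exact pow_eq_zero_iff (two_ne_zero) |>.1 (le_antisymm hq (sq_nonneg _))
    rw [← h0, this]
    nlinarith [mul_nonneg (mul_self_nonneg y) hr]
  · have : 0 ≤ p * (x * x * p + x * y * q + (y * x * q + y * y * r)) := by
      nlinarith [sq_nonneg (p * x + q * y), mul_nonneg (mul_self_nonneg y) (sub_nonneg.2 hq)]
    exact nonneg_of_mul_nonneg_right this h0

theorem schur_psd {n : ℕ} {A : Matrix (Fin (n + 1)) (Fin (n + 1)) ℝ} (hA : A.PosSemidef) :
    (Matrix.of fun i j => A i j - A i 0 * A j 0 * (A 0 0)⁻¹).PosSemidef := by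
  obtain ⟨hs, hq⟩ := (psd_iff A).1 hA
  rw [psd_iff]
  refine ⟨fun i j => by simp [hs i j, mul_comm], fun v => ?_⟩
  set L := ∑ i, v i * A i 0 with hL
  have e : ∑ i, ∑ j, v i * v j * (Matrix.of fun i j => A i j - A i 0 * A j 0 * (A 0 0)⁻¹) i j
      = ∑ i, ∑ j, v i * v j * A i j - L * L * (A 0 0)⁻¹ := by
    rw [hL, Finset.sum_mul_sum, Finset.sum_mul, ← Finset.sum_sub_distrib]
    refine Finset.sum_congr rfl fun i _ => ?_
    rw [Finset.sum_mul, ← Finset.sum_sub_distrib]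
    refine Finset.sum_congr rfl fun j _ => ?_
    simp; ring
  rw [e]
  by_cases h0 : A 0 0 = 0
  · rw [h0]; simpa using hq v
  have h1 := hq (fun i => v i - (if i = 0 then L * (A 0 0)⁻¹ else 0))
  set s := L * (A 0 0)⁻¹ with hsdef
  have e2 : ∑ i, ∑ j, (v i - (if i = 0 then s else 0)) * (v j - (if j = 0 then s else 0)) * A i j
      = ∑ i, ∑ j, v i * v j * A i j - 2 * s * L + s ^ 2 * A 0 0 := by
    have : ∀ i, ∑ j, (v i - (if i = 0 then s else 0)) * (v j - (if j = 0 then s else 0)) * A i j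
        = ∑ j, v i * v j * A i j - (if i = 0 then s else 0) * ∑ j, v j * A i j
          - s * (v i * A i 0) + (if i = 0 then s else 0) * (s * A i 0) := by
      intro i
      have : ∀ j, (v i - (if i = 0 then s else 0)) * (v j - (if j = 0 then s else 0)) * A i j
        = v i * v j * A i j - (if i = 0 then s else 0) * (v j * A i j)
          - (if j = 0 then s * (v i * A i j) - (if i = 0 then s else 0) * (s * A i j) else 0) := by
        intro j
        split_ifs <;> ring
      simp only [this, Finset.sum_sub_distrib, ← Finset.mul_sum, Finset.sum_ite_eq',
        Finset.mem_univ, if_true]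
      ring
    simp only [this, Finset.sum_sub_distrib, Finset.sum_add_distrib, ← Finset.mul_sum, ite_mul,
      zero_mul, Finset.sum_ite_eq', Finset.mem_univ, if_true]
    have : ∑ j, v j * A 0 j = L := by
      rw [hL]; exact Finset.sum_congr rfl fun j _ => by rw [hs 0 j]
    rw [this, ← hL]; ring
  rw [e2] at h1
  have : L * L * (A 0 0)⁻¹ = 2 * s * L - s ^ 2 * A 0 0 := by
    rw [hsdef]; field_simp; ring
  linarith

theorem schur_col {n : ℕ} {A : Matrix (Fin (n + 1)) (Fin (n + 1)) ℝ} (hA : A.PosSemidef)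
    (i : Fin (n + 1)) : A i 0 - A i 0 * A 0 0 * (A 0 0)⁻¹ = 0 := by
  by_cases h0 : A 0 0 = 0
  · have := psd_sq_le hA i 0
    rw [h0, mul_zero] at this
    have : A i 0 = 0 := pow_eq_zero_iff (two_ne_zero) |>.1 (le_antisymm this (sq_nonneg _))
    simp [this]
  · field_simp; ring

theorem step {n : ℕ} (f g : ℝ → ℝ) {α : ℝ} (hα : 0 ≤ α)
    (hd : ∀ x, HasDerivAt f (α * g x) x) (hmul : ∀ x y, f (x * y) = f x * f y)
    (hpos : ∀ x, 0 ≤ x → 0 ≤ f x)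
    (hg : ∀ A : Matrix (Fin n) (Fin n) ℝ, A.PosSemidef → (A.map g).PosSemidef)
    (A : Matrix (Fin (n + 1)) (Fin (n + 1)) ℝ) (hA : A.PosSemidef) : (A.map f).PosSemidef := by
  have hs := ((psd_iff A).1 hA).1
  rw [psd_iff]
  refine ⟨fun i j => by simp [hs i j], fun v => ?_⟩
  have ha : 0 ≤ (A 0 0)⁻¹ := inv_nonneg.2 (psd_diag hA 0)
  set B : Matrix (Fin (n + 1)) (Fin (n + 1)) ℝ :=
    Matrix.of fun i j => A i 0 * A j 0 * (A 0 0)⁻¹ with hB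
  set S : Matrix (Fin (n + 1)) (Fin (n + 1)) ℝ :=
    Matrix.of fun i j => A i j - A i 0 * A j 0 * (A 0 0)⁻¹ with hS
  have hSp : S.PosSemidef := schur_psd hA
  have hSs := ((psd_iff S).1 hSp).1
  have hS0 : ∀ i, S i 0 = 0 := fun i => schur_col hA i
  have hS0' : ∀ i, S 0 i = 0 := fun i => by rw [hSs, hS0]
  have rank1 : ∀ (c : ℝ) (w : Fin (n + 1) → ℝ), 0 ≤ c →
      0 ≤ ∑ i, ∑ j, v i * v j * (w i * w j * c) := by
    intro c w hc
    have : ∑ i, ∑ j, v i * v j * (w i * w j * c) = (∑ i, v i * w i) ^ 2 * c := by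
      rw [sq, Finset.sum_mul_sum, Finset.sum_mul]
      refine Finset.sum_congr rfl fun i _ => ?_
      rw [Finset.sum_mul]
      exact Finset.sum_congr rfl fun j _ => by ring
    rw [this]; positivity
  have hBp : B.PosSemidef := by
    rw [psd_iff]
    refine ⟨fun i j => by simp [hB, mul_comm], fun v => ?_⟩
    have : ∑ i, ∑ j, v i * v j * B i j = (∑ i, v i * A i 0) ^ 2 * (A 0 0)⁻¹ := by
      rw [sq, Finset.sum_mul_sum, Finset.sum_mul]
      refine Finset.sum_congr rfl fun i _ => ?_
      rw [Finset.sum_mul]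
      exact Finset.sum_congr rfl fun j _ => by simp [hB]; ring
    rw [this]; positivity
  set G : ℝ → ℝ := fun t => ∑ i, ∑ j, v i * v j * f (B i j + t * S i j) with hG
  set G' : ℝ → ℝ := fun t => ∑ i, ∑ j, v i * v j * (α * g (B i j + t * S i j) * S i j) with hG'
  have hder : ∀ t, HasDerivAt G (G' t) t := by
    intro t
    refine HasDerivAt.fun_sum fun i _ => HasDerivAt.fun_sum fun j _ => HasDerivAt.const_mul _ ?_
    have h1 : HasDerivAt (fun t => B i j + t * S i j) (S i j) t := by
      simpa using ((hasDerivAt_id t).mul_const (S i j)).const_add (B i j)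
    exact (hd _).comp t h1
  have hG'n : ∀ t, 0 ≤ t → 0 ≤ G' t := by
    intro t ht
    have hM : ((B + t • S).submatrix Fin.succ Fin.succ).PosSemidef :=
      (hBp.add (hSp.smul ht)).submatrix _
    have hH := (hg _ hM).hadamard (hSp.submatrix Fin.succ)
    have hq := ((psd_iff _).1 hH).2 (fun i => v i.succ)
    have : G' t = α * ∑ i : Fin n, ∑ j : Fin n, v i.succ * v j.succ *
        ((((B + t • S).submatrix Fin.succ Fin.succ).map g) ⊙ (S.submatrix Fin.succ Fin.succ)) i j := by
      rw [hG']
      simp only [Fin.sum_univ_succ, hS0, hS0', mul_zero, Finset.sum_const_zero, zero_add]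
      rw [Finset.mul_sum]
      refine Finset.sum_congr rfl fun i _ => ?_
      rw [Finset.mul_sum]
      refine Finset.sum_congr rfl fun j _ => ?_
      simp [Matrix.hadamard]; ring
    rw [this]
    exact mul_nonneg hα hq
  have hmono : MonotoneOn G (Set.Icc 0 1) := by
    refine monotoneOn_of_deriv_nonneg (convex_Icc 0 1)
      (fun t _ => (hder t).continuousAt.continuousWithinAt)
      (fun t _ => (hder t).differentiableAt.differentiableWithinAt) ?_
    intro t ht
    rw [interior_Icc] at ht
    rw [(hder t).deriv]
    exact hG'n t ht.1.le
  have h01 := hmono (Set.left_mem_Icc.2 zero_le_one) (Set.right_mem_Icc.2 zero_le_one) zero_le_one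
  have hG1 : G 1 = ∑ i, ∑ j, v i * v j * (A.map f) i j := by
    rw [hG]
    refine Finset.sum_congr rfl fun i _ => Finset.sum_congr rfl fun j _ => ?_
    simp [hB, hS]
  have hG0 : 0 ≤ G 0 := by
    have : G 0 = ∑ i, ∑ j, v i * v j * (f (A i 0) * f (A j 0) * f (A 0 0)⁻¹) := by
      rw [hG]
      refine Finset.sum_congr rfl fun i _ => Finset.sum_congr rfl fun j _ => ?_
      simp [hB, hmul]
    rw [this]
    exact rank1 _ (fun i => f (A i 0)) (hpos _ ha)
  rw [← hG1]
  linarith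

theorem suff_both (n : ℕ) (hn : 2 ≤ n) : ∀ α : ℝ, (n : ℝ) - 2 < α →
    (∀ A : Matrix (Fin n) (Fin n) ℝ, A.PosSemidef → (A.map (phiF α)).PosSemidef) ∧
    (∀ A : Matrix (Fin n) (Fin n) ℝ, A.PosSemidef → (A.map (psiF α)).PosSemidef) := by
  induction n, hn using Nat.le_induction with
  | base =>
    intro α hα
    have hα : 0 ≤ α := by norm_num at hα; linarith
    constructor
    · refine base_two _ hα (fun x _ => phiF_nonneg α x) (fun x => ?_) (fun x _ => rfl)
      rw [sq, sq, phiF_mul]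
    · refine base_two _ hα (fun x hx => psiF_nonneg α hx) (fun x => ?_) (fun x hx => ?_)
      · rw [psiF_eq, sq x, phiF_mul, mul_pow]
        rcases Real.sign_apply_eq x with h | h | h <;> rw [h] <;>
          nlinarith [mul_self_nonneg (phiF α x)]
      · rw [psiF_eq]
        rcases hx.eq_or_lt with h | h
        · rw [← h]; simp [phiF]
        · rw [Real.sign_of_pos h, one_mul]
  | succ n hn ih =>
    intro α hα
    have h2 : (2 : ℝ) ≤ n := by exact_mod_cast hn
    push_cast at hα
    have hα1 : 1 < α := by linarith
    obtain ⟨h3, h4⟩ := ih (α - 1) (by linarith)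
    exact ⟨step _ _ (by linarith) (phiF_deriv hα1) (phiF_mul α) (fun x _ => phiF_nonneg α x) h4,
      step _ _ (by linarith) (psiF_deriv hα1) (psiF_mul α) (fun x hx => psiF_nonneg α hx) h3⟩

open Filter Topology in
theorem suff_ge {n : ℕ} (hn : 2 ≤ n) {α : ℝ} (hα : (n : ℝ) - 2 ≤ α)
    (A : Matrix (Fin n) (Fin n) ℝ) (hA : A.PosSemidef) : (A.map (phiF α)).PosSemidef := by
  have hs := ((psd_iff A).1 hA).1
  rw [psd_iff]
  refine ⟨fun i j => by simp [hs i j], fun v => ?_⟩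
  have hc : Continuous fun β => ∑ i, ∑ j, v i * v j * (A.map (phiF β)) i j := by
    refine continuous_finsetSum _ fun i _ => continuous_finsetSum _ fun j _ => ?_
    refine continuous_const.mul ?_
    simp only [Matrix.map_apply, phiF]
    split_ifs with h
    · exact continuous_const
    · exact Real.continuous_const_rpow (abs_pos.2 h).ne'
  have ht : Tendsto (fun β => ∑ i, ∑ j, v i * v j * (A.map (phiF β)) i j) (𝓝[>] α)
      (𝓝 (∑ i, ∑ j, v i * v j * (A.map (phiF α)) i j)) :=
    (hc.tendsto α).mono_left nhdsWithin_le_nhds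
  refine ge_of_tendsto ht ?_
  filter_upwards [self_mem_nhdsWithin] with β hβ
  have hβ : α < β := hβ
  exact ((psd_iff _).1 ((suff_both n hn β (by linarith)).1 A hA)).2 v

theorem suff_even {n k : ℕ} (hk : Even k) (hk0 : 0 < k)
    (A : Matrix (Fin n) (Fin n) ℝ) (hA : A.PosSemidef) : (A.map (phiF k)).PosSemidef := by
  have h : ∀ m : ℕ, (A.map (fun x => x ^ (m + 1))).PosSemidef := by
    intro m
    induction m with
    | zero => simpa using hA
    | succ m ih =>
      have e : (A.map (fun x => x ^ (m + 1 + 1))) = (A.map (fun x => x ^ (m + 1))) ⊙ A := by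
        ext i j
        simp [Matrix.hadamard, pow_succ]
      rw [e]
      exact ih.hadamard hA
  obtain ⟨m, rfl⟩ : ∃ m, k = m + 1 := ⟨k - 1, by omega⟩
  convert h m using 2
  ext x
  unfold phiF
  split_ifs with h0
  · simp [h0]
  · rw [Real.rpow_natCast, hk.pow_abs]

/-- `H_{K_n}^φ = {even positive integers} ∪ [n - 2, ∞)`. -/
theorem stmt4 (n : ℕ) (hn : 2 ≤ n) :
    {α : ℝ | ∀ A : Matrix (Fin n) (Fin n) ℝ, A.PosSemidef → (A.map (phiF α)).PosSemidef}
      = {α : ℝ | ∃ k : ℕ, Even k ∧ 0 < k ∧ α = k} ∪ Set.Ici ((n : ℝ) - 2) := by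
  ext α
  simp only [Set.mem_ofPred_eq, Set.mem_union, Set.mem_Ici]
  constructor
  · intro h
    by_contra hc
    push Not at hc
    obtain ⟨h1, h2⟩ := hc
    rcases lt_or_ge α 0 with hneg | hpos
    · exact nec_neg hn hneg h
    have hf := Nat.floor_le hpos
    have hf2 := Nat.lt_floor_add_one α
    rcases hf.eq_or_lt with he | hlt
    · set p := ⌊α⌋₊
      have hpn : p + 3 ≤ n := by
        have : ((p + 2 : ℕ) : ℝ) < n := by push_cast; linarith
        have : p + 2 < n := by exact_mod_cast this
        omega
      rcases Nat.even_or_odd p with hev | hodd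
      · rcases Nat.eq_zero_or_pos p with h0 | h0
        · rw [← he, h0, Nat.cast_zero] at h
          exact nec_zero (by omega) h
        · exact h1 p hev h0 he.symm
      · rw [← he] at h
        exact nec_odd hodd hpn h
    · refine nec_frac hlt hf2 ?_ h
      have : ((⌊α⌋₊ + 2 : ℕ) : ℝ) < n := by push_cast; linarith
      have : ⌊α⌋₊ + 2 < n := by exact_mod_cast this
      omega
  · rintro (⟨k, hk, hk0, rfl⟩ | h)
    · exact suff_even hk hk0
    · exact suff_ge hn h
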